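/- There exists an absolute constant C>0 such that for every ψ∈𝔐_∞^+, every β∈[0,4), and every n∈ℕ with μ(ψ;n)>2, one has ∫_0^{2π}|Ψ_n(t)−Ψ̄_n(t)|dt ≤ C·ψ(n+1)·(1/n + 1/(μ(ψ;n)−2)), where Ψ_n(t)=ψ(n)/2+∑_{k=1}^∞ψ(n+k)cos kt and Ψ̄_n is the 2π-periodic step function equal to Ψ_n(x_k) on each interval [t_k,t_{k+1}), with x_k=(1+β)π/(2n)+kπ/n and t_k=x_k−π/(2n). -/

import Mathlib

open Real MeasureTheory Filter

noncomputable section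

/-- `ω` is a modulus of continuity: continuous, nondecreasing, subadditive on `[0,∞)`,
nonnegative, and `ω 0 = 0`. -/
def IsModulus (ω : ℝ → ℝ) : Prop :=
  ContinuousOn ω (Set.Ici 0) ∧ MonotoneOn ω (Set.Ici 0) ∧
  (∀ s t : ℝ, 0 ≤ s → 0 ≤ t → ω (s + t) ≤ ω s + ω t) ∧ ω 0 = 0 ∧
  ∀ t : ℝ, 0 ≤ t → 0 ≤ ω t

/-- `ψ` belongs to `𝔐_∞^+`, where `η t = ψ⁻¹(ψ t / 2)` (i.e. `η t ≥ t` and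
`ψ (η t) = ψ t / 2`) and `μ t = t / (η t − t)` is nondecreasing and tends to `∞`. -/
def IsMInfPlus (ψ η : ℝ → ℝ) : Prop :=
  (∀ t ≥ (1:ℝ), 0 < ψ t) ∧ ContinuousOn ψ (Set.Ici 1) ∧
  ConvexOn ℝ (Set.Ici 1) ψ ∧ Tendsto ψ atTop (nhds 0) ∧
  (∀ t ≥ (1:ℝ), t < η t ∧ ψ (η t) = ψ t / 2) ∧
  MonotoneOn (fun t => t / (η t - t)) (Set.Ici 1) ∧
  Tendsto (fun t => t / (η t - t)) atTop atTop


/-- The kernel `Ψ_n(t) = ψ(n)/2 + ∑_{k=1}^∞ ψ(n+k) cos kt`. -/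
def PsiN (ψ : ℝ → ℝ) (n : ℕ) (t : ℝ) : ℝ :=
  ψ n / 2 + ∑' k : ℕ, ψ ((n : ℝ) + k + 1) * Real.cos ((k + 1) * t)

/-- The points `x_k = (1+β)π/(2n) + kπ/n`. -/
def xPt (β : ℝ) (n : ℕ) (k : ℤ) : ℝ := (1 + β) * π / (2 * n) + k * π / n

/-- The index `k` with `t ∈ [t_k, t_{k+1})`, `t_k = βπ/(2n) + kπ/n`. -/
def stepIdx (β : ℝ) (n : ℕ) (t : ℝ) : ℤ := ⌊(t - β * π / (2 * n)) * n / π⌋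

/-- The step function `Ψ̄_n`, equal to `Ψ_n(x_k)` on `[t_k, t_{k+1})`. -/
def PsiBar (ψ : ℝ → ℝ) (β : ℝ) (n : ℕ) (t : ℝ) : ℝ :=
  PsiN ψ n (xPt β n (stepIdx β n t))

def cS (w : ℕ → ℝ) (m : ℕ) (t : ℝ) : ℝ := ∑ j ∈ Finset.range m, w j * Real.cos (j * t)
def sS (w : ℕ → ℝ) (m : ℕ) (t : ℝ) : ℝ := ∑ j ∈ Finset.range m, w j * Real.sin (j * t)
def qS (w : ℕ → ℝ) (m : ℕ) (t : ℝ) : ℝ := cS w m t ^ 2 + sS w m t ^ 2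

lemma cS_cont (w : ℕ → ℝ) (m : ℕ) : Continuous (cS w m) := by
  unfold cS; fun_prop

lemma sS_cont (w : ℕ → ℝ) (m : ℕ) : Continuous (sS w m) := by
  unfold sS; fun_prop

lemma qS_cont (w : ℕ → ℝ) (m : ℕ) : Continuous (qS w m) := by
  have := cS_cont w m
  have := sS_cont w m
  unfold qS; fun_prop

lemma qS_eq (w : ℕ → ℝ) (m : ℕ) (t : ℝ) :
    qS w m t = ∑ i ∈ Finset.range m, ∑ j ∈ Finset.range m,
      w i * w j * Real.cos (((i : ℝ) - j) * t) := by
  unfold qS cS sS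
  rw [sq, sq, Finset.sum_mul_sum, Finset.sum_mul_sum, ← Finset.sum_add_distrib]
  refine Finset.sum_congr rfl fun i _ => ?_
  rw [← Finset.sum_add_distrib]
  refine Finset.sum_congr rfl fun j _ => ?_
  rw [sub_mul, Real.cos_sub]; ring

lemma int_cos_int (i j : ℕ) :
    ∫ t in (0:ℝ)..(2 * π), Real.cos (((i : ℝ) - j) * t) = if i = j then 2 * π else 0 := by
  split_ifs with h
  · subst h; simp
  · have h' : ((i : ℝ) - j) ≠ 0 := by
      rw [sub_ne_zero]; exact_mod_cast h
    rw [intervalIntegral.integral_comp_mul_left (fun x => Real.cos x) h']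
    rw [integral_cos]
    have : ((i : ℝ) - j) * (2 * π) = ((i : ℤ) - (j : ℤ) : ℤ) * (2 * π) := by push_cast; ring
    rw [this, ← zero_add ((((i : ℤ) - (j : ℤ) : ℤ) : ℝ) * (2 * π)), Real.sin_add_int_mul_two_pi]
    simp

lemma qS_int (w : ℕ → ℝ) (m : ℕ) :
    ∫ t in (0:ℝ)..(2 * π), qS w m t = 2 * π * ∑ j ∈ Finset.range m, w j ^ 2 := by
  simp_rw [qS_eq]
  rw [intervalIntegral.integral_finsetSum]
  · rw [Finset.mul_sum]
    refine Finset.sum_congr rfl fun i hi => ?_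
    rw [intervalIntegral.integral_finsetSum]
    · simp_rw [intervalIntegral.integral_const_mul, int_cos_int]
      simp only [mul_ite, mul_zero, Finset.sum_ite_eq, hi, if_true]
      ring
    · intro j _
      apply Continuous.intervalIntegrable; fun_prop
  · intro i _
    apply Continuous.intervalIntegrable; fun_prop

lemma qS_per (w : ℕ → ℝ) (m : ℕ) : Function.Periodic (qS w m) (2 * π) := by
  intro t
  have hc : ∀ j : ℕ, (j:ℝ) * (t + 2 * π) = j * t + j * (2 * π) := fun j => by ring
  unfold qS cS sS
  simp only [hc, Real.cos_add_nat_mul_two_pi, Real.sin_add_nat_mul_two_pi]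

def dK (k : ℕ) (t : ℝ) : ℝ := 1 / 2 + ∑ i ∈ Finset.range k, Real.cos ((i + 1) * t)
def gK (k : ℕ) (t : ℝ) : ℝ := ∑ j ∈ Finset.range (k + 1), dK j t

lemma gK_eq (k : ℕ) (t : ℝ) : gK k t = qS (fun _ => 1) (k + 1) t / 2 := by
  induction k with
  | zero => simp [gK, dK, qS, cS, sS]
  | succ k ih =>
    have h1 : gK (k + 1) t = gK k t + dK (k + 1) t := by
      unfold gK; rw [Finset.sum_range_succ]
    have h2 : qS (fun _ => 1) (k + 1 + 1) t = qS (fun _ => 1) (k + 1) t + 1 +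
        2 * (cS (fun _ => 1) (k + 1) t * Real.cos ((k + 1 : ℕ) * t)
          + sS (fun _ => 1) (k + 1) t * Real.sin ((k + 1 : ℕ) * t)) := by
      have e1 : cS (fun _ => 1) (k + 1 + 1) t = cS (fun _ => 1) (k + 1) t
          + Real.cos ((k + 1 : ℕ) * t) := by
        unfold cS; rw [Finset.sum_range_succ]; simp
      have e2 : sS (fun _ => 1) (k + 1 + 1) t = sS (fun _ => 1) (k + 1) t
          + Real.sin ((k + 1 : ℕ) * t) := by
        unfold sS; rw [Finset.sum_range_succ]; simp
      unfold qS
      rw [e1, e2]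
      linear_combination Real.sin_sq_add_cos_sq ((k + 1 : ℕ) * t)
    have h3 : cS (fun _ => 1) (k + 1) t * Real.cos ((k + 1 : ℕ) * t)
          + sS (fun _ => 1) (k + 1) t * Real.sin ((k + 1 : ℕ) * t)
          = ∑ i ∈ Finset.range (k + 1), Real.cos ((i + 1) * t) := by
      rw [← Finset.sum_range_reflect]
      unfold cS sS
      rw [Finset.sum_mul, Finset.sum_mul, ← Finset.sum_add_distrib]
      refine Finset.sum_congr rfl fun i hi => ?_
      have hi' : i ≤ k := by simpa [Nat.lt_succ_iff] using hi
      have : (((k + 1 - 1 - i : ℕ) : ℝ) + 1) * t = ((k + 1 : ℕ) : ℝ) * t - i * t := by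
        simp only [Nat.add_sub_cancel]
        rw [Nat.cast_sub hi']; push_cast; ring
      rw [this, Real.cos_sub]; ring
    rw [h1, ih, h2, h3]
    unfold dK; ring

lemma abel (a c : ℕ → ℝ) (N : ℕ) :
    ∑ k ∈ Finset.range N, (a k - a (k + 1)) * ∑ j ∈ Finset.range (k + 1), c j
      = ∑ k ∈ Finset.range N, a k * c k - a N * ∑ j ∈ Finset.range N, c j := by
  induction N with
  | zero => simp
  | succ N ih =>
    rw [Finset.sum_range_succ, ih, Finset.sum_range_succ (fun k => a k * c k),
      Finset.sum_range_succ c]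
    ring

lemma abel2 (a c : ℕ → ℝ) (N : ℕ) (h : ∀ k, N ≤ k → a k = 0) :
    ∑ k ∈ Finset.range N, (a k - 2 * a (k + 1) + a (k + 2)) *
      ∑ i ∈ Finset.range (k + 1), ∑ j ∈ Finset.range (i + 1), c j
      = ∑ k ∈ Finset.range N, a k * c k := by
  have h1 := abel (fun k => a k - a (k + 1)) (fun i => ∑ j ∈ Finset.range (i + 1), c j) N
  have h2 := abel a c N
  simp only [h N le_rfl, h (N + 1) (Nat.le_succ N), sub_zero, zero_mul] at h1 h2
  rw [← h2, ← h1]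
  refine Finset.sum_congr rfl fun k _ => ?_
  ring

/-- The finite kernel. -/
lemma fin_kernel (a : ℕ → ℝ) (N : ℕ) (h : ∀ k, N ≤ k → a k = 0) (t : ℝ) :
    a 0 / 2 + ∑ k ∈ Finset.range N, a (k + 1) * Real.cos ((k + 1) * t)
      = ∑ k ∈ Finset.range N, (a k - 2 * a (k + 1) + a (k + 2)) * gK k t := by
  have := abel2 a (fun k => if k = 0 then 1 / 2 else Real.cos (k * t)) N h
  have hd : ∀ i, ∑ j ∈ Finset.range (i + 1), (if j = 0 then 1 / 2 else Real.cos (j * t))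
      = dK i t := by
    intro i
    rw [Finset.sum_range_succ']
    unfold dK
    simp [add_comm]
  simp only [hd] at this
  unfold gK
  rw [this]
  have e : ∑ k ∈ Finset.range (N + 1), a k * (if k = 0 then 1 / 2 else Real.cos (k * t))
    = ∑ k ∈ Finset.range N, a k * (if k = 0 then 1 / 2 else Real.cos (k * t)) := by
    rw [Finset.sum_range_succ, h N le_rfl]; simp
  rw [← e, Finset.sum_range_succ']
  simp
  ring

lemma fin_sum (a : ℕ → ℝ) (N : ℕ) (h : ∀ k, N ≤ k → a k = 0) :
    ∑ k ∈ Finset.range N, (a k - 2 * a (k + 1) + a (k + 2)) * ((k : ℝ) * (k + 1))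
      = 2 * ∑ k ∈ Finset.range N, a (k + 1) := by
  have := abel2 a (fun k => if k = 0 then 0 else 2) N h
  have hd : ∀ i : ℕ, ∑ j ∈ Finset.range (i + 1), (if j = 0 then (0:ℝ) else 2) = 2 * i := by
    intro i
    rw [Finset.sum_range_succ']
    simp [mul_comm]
  have hd2 : ∀ i : ℕ, ∑ j ∈ Finset.range (i + 1), (2:ℝ) * j = i * (i + 1) := by
    intro i
    induction i with
    | zero => simp
    | succ i ih => rw [Finset.sum_range_succ, ih]; push_cast; ring
  simp only [hd, hd2] at this
  rw [this]
  have e : ∑ k ∈ Finset.range (N + 1), a k * (if k = 0 then (0:ℝ) else 2)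
    = ∑ k ∈ Finset.range N, a k * (if k = 0 then 0 else 2) := by
    rw [Finset.sum_range_succ, h N le_rfl]; simp
  rw [← e, Finset.sum_range_succ', Finset.mul_sum]
  simp [mul_comm]

def bK (k : ℕ) (t : ℝ) : ℝ :=
  (k * qS (fun _ => 1) (k + 1) t + qS (fun j => (j:ℝ)) (k + 1) t / k) / 2

lemma bK_cont (k : ℕ) : Continuous (bK k) := by
  have := qS_cont (fun _ => 1) (k + 1)
  have := qS_cont (fun j => (j:ℝ)) (k + 1)
  unfold bK; fun_prop

lemma bK_per (k : ℕ) : Function.Periodic (bK k) (2 * π) := by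
  intro t
  unfold bK
  rw [qS_per, qS_per]

lemma bK_nonneg (k : ℕ) (t : ℝ) : 0 ≤ bK k t := by
  unfold bK qS; positivity

lemma bK_int (k : ℕ) : ∫ t in (0:ℝ)..(2 * π), bK k t ≤ 2 * π * (k * (k + 1)) := by
  unfold bK
  have c1 := qS_cont (fun _ => 1) (k + 1)
  have c2 := qS_cont (fun j => (j:ℝ)) (k + 1)
  rw [intervalIntegral.integral_div, intervalIntegral.integral_add
    (by apply Continuous.intervalIntegrable; fun_prop)
    (by apply Continuous.intervalIntegrable; fun_prop),
    intervalIntegral.integral_const_mul, intervalIntegral.integral_div, qS_int, qS_int]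
  have hs : ∑ j ∈ Finset.range (k + 1), (j:ℝ) ^ 2 ≤ (k + 1) * (k:ℝ) ^ 2 := by
    have := Finset.sum_le_card_nsmul (Finset.range (k + 1)) (fun j => (j:ℝ) ^ 2) ((k:ℝ) ^ 2) ?_
    · simpa using this
    · intro j hj
      have : j ≤ k := by simpa [Nat.lt_succ_iff] using hj
      have : (j:ℝ) ≤ k := by exact_mod_cast this
      gcongr
  have hpi := Real.pi_pos
  rcases Nat.eq_zero_or_pos k with rfl | hk
  · simp
  · have hk' : (0:ℝ) < k := by exact_mod_cast hk
    have : 2 * π * (∑ j ∈ Finset.range (k + 1), (j:ℝ) ^ 2) / k ≤ 2 * π * (k * (k + 1)) := by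
      rw [div_le_iff₀ hk']
      nlinarith
    simp only [one_pow, Finset.sum_const, Finset.card_range, nsmul_eq_mul, mul_one]
    push_cast
    linarith

lemma gK_deriv (k : ℕ) (t : ℝ) : ∃ d, HasDerivAt (gK k) d t ∧ |d| ≤ bK k t := by
  set C := cS (fun _ => 1) (k + 1) t with hC
  set S := sS (fun _ => 1) (k + 1) t with hS
  set P := cS (fun j => (j:ℝ)) (k + 1) t with hP
  set R := sS (fun j => (j:ℝ)) (k + 1) t with hR
  have h1 : HasDerivAt (cS (fun _ => 1) (k + 1)) (-R) t := by
    have : HasDerivAt (fun t : ℝ => ∑ j ∈ Finset.range (k + 1), (1:ℝ) * Real.cos (j * t))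
        (∑ j ∈ Finset.range (k + 1), (1:ℝ) * (-Real.sin (j * t) * (j * 1))) t := by
      apply HasDerivAt.fun_sum
      intro j _
      exact (((hasDerivAt_id t).const_mul (j:ℝ)).cos).const_mul 1
    refine HasDerivAt.congr_deriv (f := cS (fun _ => 1) (k + 1)) this ?_
    symm
    rw [hR]; unfold sS
    rw [← Finset.sum_neg_distrib]
    refine Finset.sum_congr rfl fun j _ => by ring
  have h2 : HasDerivAt (sS (fun _ => 1) (k + 1)) P t := by
    have : HasDerivAt (fun t : ℝ => ∑ j ∈ Finset.range (k + 1), (1:ℝ) * Real.sin (j * t))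
        (∑ j ∈ Finset.range (k + 1), (1:ℝ) * (Real.cos (j * t) * (j * 1))) t := by
      apply HasDerivAt.fun_sum
      intro j _
      exact (((hasDerivAt_id t).const_mul (j:ℝ)).sin).const_mul 1
    refine HasDerivAt.congr_deriv (f := sS (fun _ => 1) (k + 1)) this ?_
    symm
    rw [hP]; unfold cS
    refine Finset.sum_congr rfl fun j _ => by ring
  refine ⟨S * P - C * R, ?_, ?_⟩
  · have h3 : HasDerivAt (fun t => (cS (fun _ => 1) (k + 1) t ^ 2 + sS (fun _ => 1) (k + 1) t ^ 2) / 2)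
        _ t := ((h1.pow 2).add (h2.pow 2)).div_const 2
    have h4 : gK k = (fun t => (cS (fun _ => 1) (k + 1) t ^ 2 + sS (fun _ => 1) (k + 1) t ^ 2) / 2) := by
      funext u; rw [gK_eq]; rfl
    rw [h4]
    convert h3 using 1
    push_cast
    ring
  · rcases Nat.eq_zero_or_pos k with rfl | hk
    · have : P = 0 := by rw [hP]; simp [cS]
      have hR0 : R = 0 := by rw [hR]; simp [sS]
      rw [this, hR0]
      simp [bK]
    · have hk' : (0:ℝ) < k := by exact_mod_cast hk
      have : bK k t = (k * (C ^ 2 + S ^ 2) + (P ^ 2 + R ^ 2) / k) / 2 := rfl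
      rw [this, abs_le]
      have e : (k * (C ^ 2 + S ^ 2) + (P ^ 2 + R ^ 2) / k) / 2
        = ((k * C) ^ 2 + (k * S) ^ 2 + (P ^ 2 + R ^ 2)) / (2 * k) := by field_simp
      rw [e]
      constructor
      · rw [neg_le, le_div_iff₀ (by positivity)]
        nlinarith [sq_nonneg (k * C - R), sq_nonneg (k * S + P)]
      · rw [le_div_iff₀ (by positivity)]
        nlinarith [sq_nonneg (k * C + R), sq_nonneg (k * S - P)]

def hK (h : ℝ) (k : ℕ) (t : ℝ) : ℝ := ∫ v in (-h)..h, bK k (t + v)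

lemma gK_diff_aux (k : ℕ) (x y : ℝ) (hxy : x ≤ y) :
    |gK k y - gK k x| ≤ ∫ u in x..y, bK k u := by
  choose d hd hb using gK_deriv k
  have hA : ∀ u, HasDerivAt (fun u => ∫ v in x..u, bK k v) (bK k u) u := fun u =>
    intervalIntegral.integral_hasDerivAt_right ((bK_cont k).intervalIntegrable _ _)
      ((bK_cont k).stronglyMeasurableAtFilter _ _) (bK_cont k).continuousAt
  have m1 : Monotone (fun u => (∫ v in x..u, bK k v) - gK k u) := by
    apply monotone_of_hasDerivAt_nonneg (fun u => (hA u).sub (hd u))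
    intro u
    have := (abs_le.1 (hb u)).2
    simp only [Pi.zero_apply]; linarith
  have m2 : Monotone (fun u => (∫ v in x..u, bK k v) + gK k u) := by
    apply monotone_of_hasDerivAt_nonneg (fun u => (hA u).add (hd u))
    intro u
    have := (abs_le.1 (hb u)).1
    simp only [Pi.zero_apply]; linarith
  have a1 := m1 hxy
  have a2 := m2 hxy
  simp only [intervalIntegral.integral_same] at a1 a2
  rw [abs_le]; constructor <;> linarith

lemma gK_diff (k : ℕ) (h t x : ℝ) (hx : |t - x| ≤ h) :
    |gK k t - gK k x| ≤ hK h k t := by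
  have e : hK h k t = ∫ u in (t - h)..(t + h), bK k u := by
    unfold hK
    rw [intervalIntegral.integral_comp_add_left (fun u => bK k u)]
    simp [sub_eq_add_neg]
  rw [e]
  have hx' := abs_le.1 hx
  have key : ∀ a b, t - h ≤ a → a ≤ b → b ≤ t + h →
      ∫ u in a..b, bK k u ≤ ∫ u in (t - h)..(t + h), bK k u := by
    intro a b h1 h2 h3
    exact intervalIntegral.integral_mono_interval h1 h2 h3
      (Filter.Eventually.of_forall (fun u => bK_nonneg k u)) ((bK_cont k).intervalIntegrable _ _)
  have h0 : 0 ≤ h := (abs_nonneg _).trans hx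
  rcases le_total x t with hh | hh
  · exact (gK_diff_aux k x t hh).trans (key _ _ (by linarith) hh (by linarith))
  · rw [abs_sub_comm]
    exact (gK_diff_aux k t x hh).trans (key _ _ (by linarith) hh (by linarith))

lemma hK_cont (h : ℝ) (k : ℕ) : Continuous (hK h k) := by
  have := bK_cont k
  unfold hK
  apply intervalIntegral.continuous_parametric_intervalIntegral_of_continuous'
  fun_prop

lemma hK_int (h : ℝ) (h0 : 0 ≤ h) (k : ℕ) :
    ∫ t in (0:ℝ)..(2 * π), hK h k t ≤ 4 * π * h * (k * (k + 1)) := by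
  unfold hK
  have hpi := Real.pi_pos
  have hb := bK_cont k
  have hint : Integrable (Function.uncurry fun t v => bK k (t + v))
      ((volume.restrict (Set.uIoc (0:ℝ) (2 * π))).prod (volume.restrict (Set.Ioc (-h) h))) := by
    rw [Measure.prod_restrict]
    have hc : Continuous (Function.uncurry fun t v => bK k (t + v)) := by fun_prop
    have : IntegrableOn (Function.uncurry fun t v => bK k (t + v))
        (Set.Icc (0:ℝ) (2 * π) ×ˢ Set.Icc (-h) h) (volume.prod volume) :=
      hc.continuousOn.integrableOn_compact (isCompact_Icc.prod isCompact_Icc)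
    apply this.mono_set
    rw [Set.uIoc_of_le (by positivity)]
    exact Set.prod_mono Set.Ioc_subset_Icc_self Set.Ioc_subset_Icc_self
  have e := intervalIntegral_integral_swap hint
  simp_rw [intervalIntegral.integral_of_le (show -h ≤ h by linarith)]
  rw [e]
  have e2 : ∀ v, ∫ t in (0:ℝ)..(2 * π), bK k (t + v) = ∫ t in (0:ℝ)..(2 * π), bK k t := by
    intro v
    rw [intervalIntegral.integral_comp_add_right (fun t => bK k t)]
    have := (bK_per k).intervalIntegral_add_eq v 0
    simp only [zero_add] at this ⊢
    rw [add_comm, this]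
  simp_rw [e2]
  rw [← intervalIntegral.integral_of_le (show -h ≤ h by linarith), intervalIntegral.integral_const]
  have := bK_int k
  simp only [smul_eq_mul]
  nlinarith

lemma main_seq (p : ℕ → ℝ) (hp : ∀ k, 0 ≤ p k) (hanti : Antitone p)
    (hconv : ∀ k, 0 ≤ p k - 2 * p (k + 1) + p (k + 2)) (hsum : Summable fun k => p (k + 1))
    (x : ℝ → ℝ) (h : ℝ) (h0 : 0 ≤ h) (hx : ∀ t, |t - x t| ≤ h) :
    ∫ t in (0:ℝ)..(2 * π), |(p 0 / 2 + ∑' k : ℕ, p (k + 1) * Real.cos ((k + 1) * t))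
      - (p 0 / 2 + ∑' k : ℕ, p (k + 1) * Real.cos ((k + 1) * x t))|
      ≤ 8 * π * h * ∑' k, p (k + 1) := by
  have hpi := Real.pi_pos
  set a : ℕ → ℕ → ℝ := fun N k => max (p k - p N) 0 with ha
  have ha0 : ∀ N k, 0 ≤ a N k := fun N k => le_max_right _ _
  have hap : ∀ N k, a N k ≤ p k := fun N k => max_le (by linarith [hp N]) (hp k)
  have haz : ∀ N k, N ≤ k → a N k = 0 := fun N k hk => max_eq_right (by linarith [hanti hk])
  have hac : ∀ N k, 0 ≤ a N k - 2 * a N (k + 1) + a N (k + 2) := by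
    intro N k
    have h1 : p k - p N ≤ a N k := le_max_left _ _
    have h2 : p (k + 2) - p N ≤ a N (k + 2) := le_max_left _ _
    have h3 := hconv k
    have h4 := ha0 N k
    have h5 := ha0 N (k + 2)
    rcases max_choice (p (k + 1) - p N) 0 with h | h
    · have : a N (k + 1) = p (k + 1) - p N := h
      linarith
    · have : a N (k + 1) = 0 := h
      linarith
  set E : ℕ → ℝ := fun N => ∑' k, (p (k + 1) - a N (k + 1)) with hE
  have hpz : Tendsto p atTop (nhds 0) := (tendsto_add_atTop_iff_nat 1).1 hsum.tendsto_atTop_zero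
  have hE0 : Tendsto E atTop (nhds 0) := by
    have := tendsto_tsum_of_dominated_convergence (𝓕 := atTop)
      (f := fun N k => p (k + 1) - a N (k + 1)) (g := fun _ => (0:ℝ)) hsum ?_ ?_
    · simpa using this
    · intro k
      have : Tendsto (fun N => p (k + 1) - max (p (k + 1) - p N) 0) atTop
          (nhds (p (k + 1) - max (p (k + 1) - 0) 0)) :=
        tendsto_const_nhds.sub ((tendsto_const_nhds.sub hpz).max tendsto_const_nhds)
      simpa [max_eq_left (hp (k + 1))] using this
    · refine Filter.Eventually.of_forall fun N k => ?_
      rw [Real.norm_eq_abs, abs_le]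
      constructor <;> linarith [hap N (k + 1), ha0 N (k + 1), hp (k + 1)]
  have hsa : ∀ N, Summable fun k => a N (k + 1) := fun N =>
    hsum.of_nonneg_of_le (fun k => ha0 N _) (fun k => hap N _)
  have hcos : ∀ (f : ℕ → ℝ) (_ : ∀ k, 0 ≤ f k) (_ : Summable f) (t : ℝ),
      Summable (fun k : ℕ => f k * Real.cos ((k + 1) * t)) ∧
      |∑' k : ℕ, f k * Real.cos ((k + 1) * t)| ≤ ∑' k, f k := by
    intro f hf hs t
    have hb : ∀ k : ℕ, ‖f k * Real.cos ((k + 1) * t)‖ ≤ f k := by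
      intro k
      rw [norm_mul, Real.norm_eq_abs, Real.norm_eq_abs, abs_of_nonneg (hf k)]
      exact mul_le_of_le_one_right (hf k) (Real.abs_cos_le_one _)
    exact ⟨Summable.of_norm_bounded hs hb, tsum_of_norm_bounded hs.hasSum hb⟩
  have hF : ∀ N t, |(∑' k : ℕ, p (k + 1) * Real.cos ((k + 1) * t))
      - ∑ k ∈ Finset.range N, a N (k + 1) * Real.cos ((k + 1) * t)| ≤ E N := by
    intro N t
    have e : ∑ k ∈ Finset.range N, a N (k + 1) * Real.cos ((k + 1) * t)
        = ∑' k : ℕ, a N (k + 1) * Real.cos ((k + 1) * t) := by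
      rw [tsum_eq_sum]
      intro k hk
      rw [haz N (k + 1) (by simp at hk; omega), zero_mul]
    rw [e, ← Summable.tsum_sub (hcos _ (fun k => hp (k + 1)) hsum t).1
      (hcos _ (fun k => ha0 N (k + 1)) (hsa N) t).1]
    simp_rw [← sub_mul]
    exact (hcos (fun k => p (k + 1) - a N (k + 1)) (fun k => by linarith [hap N (k + 1)])
      (hsum.sub (hsa N)) t).2
  have hpt : ∀ N t, |(p 0 / 2 + ∑' k : ℕ, p (k + 1) * Real.cos ((k + 1) * t))
      - (p 0 / 2 + ∑' k : ℕ, p (k + 1) * Real.cos ((k + 1) * x t))| ≤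
      2 * E N + ∑ k ∈ Finset.range N, (a N k - 2 * a N (k + 1) + a N (k + 2)) * hK h k t := by
    intro N t
    have h1 := abs_le.1 (hF N t)
    have h2 := abs_le.1 (hF N (x t))
    have k1 := fin_kernel (a N) N (haz N) t
    have k2 := fin_kernel (a N) N (haz N) (x t)
    have h3 : |∑ k ∈ Finset.range N, (a N k - 2 * a N (k + 1) + a N (k + 2)) * gK k t
      - ∑ k ∈ Finset.range N, (a N k - 2 * a N (k + 1) + a N (k + 2)) * gK k (x t)| ≤
      ∑ k ∈ Finset.range N, (a N k - 2 * a N (k + 1) + a N (k + 2)) * hK h k t := by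
      rw [← Finset.sum_sub_distrib]
      refine (Finset.abs_sum_le_sum_abs _ _).trans (Finset.sum_le_sum fun k _ => ?_)
      rw [← mul_sub, abs_mul, abs_of_nonneg (hac N k)]
      exact mul_le_mul_of_nonneg_left (gK_diff k h t (x t) (hx t)) (hac N k)
    rw [← k1, ← k2] at h3
    have h4 := abs_le.1 h3
    rw [abs_le]
    constructor <;> linarith [h1.1, h1.2, h2.1, h2.2, h4.1, h4.2]
  have hfin : ∀ N, ∫ t in (0:ℝ)..(2 * π), |(p 0 / 2 + ∑' k : ℕ, p (k + 1) * Real.cos ((k + 1) * t))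
      - (p 0 / 2 + ∑' k : ℕ, p (k + 1) * Real.cos ((k + 1) * x t))|
      ≤ 4 * π * E N + 8 * π * h * ∑' k, p (k + 1) := by
    intro N
    have hcK := hK_cont h
    have hcont : Continuous fun t => 2 * E N +
        ∑ k ∈ Finset.range N, (a N k - 2 * a N (k + 1) + a N (k + 2)) * hK h k t := by
      fun_prop
    have hle : (∫ t in (0:ℝ)..(2 * π), |(p 0 / 2 + ∑' k : ℕ, p (k + 1) * Real.cos ((k + 1) * t))
      - (p 0 / 2 + ∑' k : ℕ, p (k + 1) * Real.cos ((k + 1) * x t))|) ≤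
      ∫ t in (0:ℝ)..(2 * π), (2 * E N +
        ∑ k ∈ Finset.range N, (a N k - 2 * a N (k + 1) + a N (k + 2)) * hK h k t) := by
      rw [intervalIntegral.integral_of_le (by positivity),
        intervalIntegral.integral_of_le (by positivity)]
      apply integral_mono_of_nonneg
      · exact Filter.Eventually.of_forall fun t => abs_nonneg _
      · exact (hcont.intervalIntegrable 0 (2 * π)).1
      · exact Filter.Eventually.of_forall fun t => hpt N t
    refine hle.trans ?_
    rw [intervalIntegral.integral_add (by simp)
      (by apply Continuous.intervalIntegrable; fun_prop), intervalIntegral.integral_const,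
      intervalIntegral.integral_finsetSum
      (fun k _ => by apply Continuous.intervalIntegrable; fun_prop)]
    simp_rw [intervalIntegral.integral_const_mul]
    have s1 : ∑ k ∈ Finset.range N, (a N k - 2 * a N (k + 1) + a N (k + 2)) *
        ∫ t in (0:ℝ)..(2 * π), hK h k t ≤
        ∑ k ∈ Finset.range N, (4 * π * h) *
          ((a N k - 2 * a N (k + 1) + a N (k + 2)) * ((k : ℝ) * (k + 1))) := by
      refine Finset.sum_le_sum fun k _ => ?_
      have := mul_le_mul_of_nonneg_left (hK_int h h0 k) (hac N k)
      linarith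
    rw [← Finset.mul_sum, fin_sum (a N) N (haz N)] at s1
    have s2 : ∑ k ∈ Finset.range N, a N (k + 1) ≤ ∑' k, p (k + 1) :=
      (Finset.sum_le_sum fun k _ => hap N (k + 1)).trans
        (hsum.sum_le_tsum _ (fun k _ => hp (k + 1)))
    have s3 := mul_le_mul_of_nonneg_left s2 (show 0 ≤ 8 * π * h by positivity)
    simp only [smul_eq_mul]
    linarith
  have hlim : Tendsto (fun N => 4 * π * E N + 8 * π * h * ∑' k, p (k + 1)) atTop
      (nhds (4 * π * 0 + 8 * π * h * ∑' k, p (k + 1))) :=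
    (hE0.const_mul _).add tendsto_const_nhds
  have := ge_of_tendsto' hlim hfin
  simpa using this

lemma anti_of_conv (ψ : ℝ → ℝ) (hpos : ∀ t ≥ (1:ℝ), 0 < ψ t)
    (hconv : ConvexOn ℝ (Set.Ici 1) ψ) (hlim : Tendsto ψ atTop (nhds 0)) :
    AntitoneOn ψ (Set.Ici 1) := by
  intro x hx y hy hxy
  by_contra! hlt
  have hxy' : x < y := lt_of_le_of_ne hxy (fun e => by subst e; exact lt_irrefl _ hlt)
  have : ∀ᶠ z in atTop, ψ y ≤ ψ z := by
    filter_upwards [eventually_gt_atTop y] with z hz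
    have hz1 : z ∈ Set.Ici (1:ℝ) := le_trans (Set.mem_Ici.1 hy) hz.le
    have h1 := hconv.slope_mono_adjacent hx hz1 hxy' hz
    have h2 : 0 < (ψ y - ψ x) / (y - x) := div_pos (by linarith) (by linarith)
    have h3 : 0 < (ψ z - ψ y) / (z - y) := h2.trans_le h1
    have h4 : 0 < ψ z - ψ y := (div_pos_iff_of_pos_right (by linarith)).1 h3
    linarith
  have h5 := ge_of_tendsto hlim this
  linarith [hpos y hy]

lemma int_bound (ψ : ℝ → ℝ) (s q : ℝ) (hs : 1 ≤ s) (hq : 1 < q) (hq2 : q < 2)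
    (hpos : ∀ t ≥ (1:ℝ), 0 < ψ t) (hanti : AntitoneOn ψ (Set.Ici 1))
    (hcont : ContinuousOn ψ (Set.Ici 1))
    (hhalf : ∀ t, s ≤ t → ψ (q * t) ≤ ψ t / 2) (T : ℝ) (hT : s ≤ T) :
    (1 - q / 2) * ∫ u in s..T, ψ u ≤ s * (q - 1) * ψ s := by
  have hii : ∀ a b : ℝ, 1 ≤ a → 1 ≤ b → IntervalIntegrable ψ volume a b := by
    intro a b ha hb
    apply (hcont.mono _).intervalIntegrable
    intro u hu
    rw [Set.mem_uIcc] at hu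
    rw [Set.mem_Ici]
    rcases hu with hu | hu <;> linarith [hu.1]
  have hsq : s ≤ q * s := by nlinarith
  have hTq : T ≤ q * T := by nlinarith
  have hsT : q * s ≤ q * T := by nlinarith
  have e1 : ∫ u in (q * s)..(q * T), ψ u = q * ∫ u in s..T, ψ (q * u) := by
    rw [intervalIntegral.integral_comp_mul_left ψ (by linarith : q ≠ 0), smul_eq_mul]
    field_simp
  have e2 : ∫ u in s..T, ψ (q * u) ≤ ∫ u in s..T, ψ u / 2 := by
    apply intervalIntegral.integral_mono_on hT
    · apply ContinuousOn.intervalIntegrable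
      apply hcont.comp (by fun_prop)
      intro u hu
      rw [Set.uIcc_of_le hT] at hu
      rw [Set.mem_Ici]
      nlinarith [hu.1]
    · exact (hii s T hs (by linarith)).div_const 2
    · intro u hu
      exact hhalf u hu.1
  rw [intervalIntegral.integral_div] at e2
  have e3 : ∫ u in s..(q * s), ψ u ≤ ∫ u in s..(q * s), ψ s := by
    apply intervalIntegral.integral_mono_on hsq (hii _ _ hs (by linarith)) (by simp)
    intro u hu
    exact hanti hs (show (1:ℝ) ≤ u by linarith [hu.1]) hu.1
  rw [intervalIntegral.integral_const, smul_eq_mul] at e3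
  have e4 : ∫ u in s..T, ψ u ≤ ∫ u in s..(q * T), ψ u := by
    rw [← intervalIntegral.integral_add_adjacent_intervals (hii s T hs (by linarith))
      (hii T (q * T) (by linarith) (by linarith))]
    have : 0 ≤ ∫ u in T..(q * T), ψ u :=
      intervalIntegral.integral_nonneg hTq fun u hu => (hpos u (by linarith [hu.1])).le
    linarith
  rw [← intervalIntegral.integral_add_adjacent_intervals (hii s (q * s) hs (by linarith))
    (hii (q * s) (q * T) (by linarith) (by linarith)), e1] at e4
  have e5 := mul_le_mul_of_nonneg_left e2 (show 0 ≤ q by linarith)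
  linarith

lemma sum_bound (ψ η : ℝ → ℝ) (hM : IsMInfPlus ψ η) (n : ℕ) (hn : 1 ≤ n)
    (hmu : 2 < (n : ℝ) / (η n - n)) (K : ℕ) :
    ∑ k ∈ Finset.range K, ψ ((n:ℝ) + k + 1) ≤
      ψ (n + 1) * (1 + 4 * n / ((n : ℝ) / (η n - n) - 2)) := by
  obtain ⟨hpos, hcont, hconv, hlim, hη, hmono, -⟩ := hM
  have hanti := anti_of_conv ψ hpos hconv hlim
  have hn1 : (1:ℝ) ≤ n := by exact_mod_cast hn
  set m := (n : ℝ) / (η n - n) with hm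
  have hm0 : 0 < m := by linarith
  set q := 1 + 1 / m with hq
  have hq1 : 1 < q := by rw [hq]; linarith [one_div_pos.2 hm0]
  have hq2 : q < 2 := by
    have : 1 / m < 1 := by rw [div_lt_one hm0]; linarith
    linarith
  set s : ℝ := n + 1 with hs
  have hψs : 0 < ψ s := hpos s (by linarith)
  have hhalf : ∀ t, s ≤ t → ψ (q * t) ≤ ψ t / 2 := by
    intro t ht
    have ht1 : (1:ℝ) ≤ t := by linarith
    obtain ⟨h1, h2⟩ := hη t ht1
    have h3 : m ≤ t / (η t - t) := hmono (show (1:ℝ) ≤ n from hn1) ht1 (by linarith)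
    rw [le_div_iff₀ (by linarith)] at h3
    rw [← h2]
    apply hanti
    · exact Set.mem_Ici.2 (by linarith)
    · exact Set.mem_Ici.2 (by nlinarith)
    · have : η t - t ≤ t / m := by rw [le_div_iff₀ hm0]; linarith
      have : q * t = t + t / m := by rw [hq]; ring
      linarith
  have hI : ∀ T, s ≤ T → ∫ u in s..T, ψ u ≤ 4 * n / (m - 2) * ψ s := by
    intro T hT
    have h1 := int_bound ψ s q (by linarith) hq1 hq2 hpos hanti hcont hhalf T hT
    have h2 : (1 - q / 2) = (m - 1) / (2 * m) := by rw [hq]; field_simp; ring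
    have h3 : s * (q - 1) * ψ s = (2 * s * ψ s) / (2 * m) := by rw [hq]; field_simp; ring
    rw [h2, h3, div_mul_eq_mul_div, div_le_div_iff_of_pos_right (by positivity)] at h1
    have h0 : 0 ≤ ∫ u in s..T, ψ u :=
      intervalIntegral.integral_nonneg hT fun u hu => (hpos u (by linarith [hu.1])).le
    rw [div_mul_eq_mul_div, le_div_iff₀ (by linarith)]
    nlinarith
  have hnn : 0 ≤ 4 * (n:ℝ) / (m - 2) * ψ s :=
    mul_nonneg (div_nonneg (by positivity) (by linarith)) hψs.le
  cases K with
  | zero => simp only [Finset.range_zero, Finset.sum_empty]; nlinarith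
  | succ K =>
    rw [Finset.sum_range_succ']
    have h1 := AntitoneOn.sum_le_integral (x₀ := s) (a := K) (f := ψ)
      (hanti.mono fun u hu => by
        have := hu.1
        exact Set.mem_Ici.2 (by linarith))
    have h2 := hI (s + K) (by linarith [Nat.cast_nonneg (α := ℝ) K])
    have h3 : ∑ k ∈ Finset.range K, ψ ((n:ℝ) + (k + 1 : ℕ) + 1)
        = ∑ i ∈ Finset.range K, ψ (s + (i + 1 : ℕ)) := by
      refine Finset.sum_congr rfl fun k _ => ?_
      congr 1; rw [hs]; ring
    rw [h3]
    simp only [Nat.cast_zero, add_zero]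
    linarith

lemma step_close (β : ℝ) (n : ℕ) (hn : 1 ≤ n) (t : ℝ) :
    |t - xPt β n (stepIdx β n t)| ≤ π / (2 * n) := by
  have hn1 : (0:ℝ) < n := by exact_mod_cast hn
  have hpi := Real.pi_pos
  set y := (t - β * π / (2 * n)) * n / π with hy
  have h1 : (stepIdx β n t : ℝ) ≤ y := Int.floor_le _
  have h2 : y < (stepIdx β n t : ℝ) + 1 := Int.lt_floor_add_one _
  have e : t - xPt β n (stepIdx β n t) = (y - stepIdx β n t - 1 / 2) * (π / n) := by
    rw [hy]; unfold xPt; field_simp; ring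
  rw [e, abs_mul, abs_of_pos (div_pos hpi hn1)]
  have : |y - stepIdx β n t - 1 / 2| ≤ 1 / 2 := by
    rw [abs_le]; constructor <;> linarith
  calc _ ≤ 1 / 2 * (π / n) := mul_le_mul_of_nonneg_right this (by positivity)
    _ = _ := by field_simp

/-- Estimate (34): there is an absolute constant `C > 0` such that for every
`ψ ∈ 𝔐_∞^+`, `β ∈ [0,4)` and `n` with `μ(n) > 2`,
`∫_0^{2π} |Ψ_n(t) − Ψ̄_n(t)| dt ≤ C ψ(n+1)(1/n + 1/(μ(n)−2))`. -/
theorem statement19 :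
    ∃ C : ℝ, 0 < C ∧ ∀ ψ η : ℝ → ℝ, IsMInfPlus ψ η → ∀ β : ℝ,
      0 ≤ β → β < 4 → ∀ n : ℕ,
      2 < (n : ℝ) / (η n - n) →
      (∫ t in (0:ℝ)..(2 * π), |PsiN ψ n t - PsiBar ψ β n t|) ≤
        C * ψ (n + 1) * (1 / n + 1 / ((n : ℝ) / (η n - n) - 2)) := by
  refine ⟨16 * π ^ 2, by positivity, ?_⟩
  intro ψ η hM β _ _ n hmu
  have hn : 1 ≤ n := by
    rcases Nat.eq_zero_or_pos n with rfl | h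
    · norm_num at hmu
    · exact h
  have hn1 : (1:ℝ) ≤ n := by exact_mod_cast hn
  have hpi := Real.pi_pos
  have hsb := sum_bound ψ η hM n hn hmu
  obtain ⟨hpos, hcont, hconv, hlim, hη, hmono, -⟩ := hM
  have hanti := anti_of_conv ψ hpos hconv hlim
  set p : ℕ → ℝ := fun k => ψ ((n:ℝ) + k) with hp
  have hp1 : ∀ k : ℕ, p (k + 1) = ψ ((n:ℝ) + k + 1) := by
    intro k; simp only [hp]; congr 1; push_cast; ring
  have hge : ∀ k : ℕ, (1:ℝ) ≤ (n:ℝ) + k := fun k => by linarith [Nat.cast_nonneg (α := ℝ) k]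
  have hp0 : ∀ k, 0 ≤ p k := fun k => (hpos _ (hge k)).le
  have hpa : Antitone p := by
    intro i j hij
    have : (i:ℝ) ≤ j := by exact_mod_cast hij
    exact hanti (hge i) (hge j) (by linarith)
  have hpc : ∀ k, 0 ≤ p k - 2 * p (k + 1) + p (k + 2) := by
    intro k
    have := hconv.2 (hge k) (hge (k + 2)) (show (0:ℝ) ≤ 1 / 2 by norm_num)
      (show (0:ℝ) ≤ 1 / 2 by norm_num) (by norm_num)
    have e : (1 / 2 : ℝ) • ((n:ℝ) + k) + (1 / 2 : ℝ) • ((n:ℝ) + (k + 2 : ℕ))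
        = (n:ℝ) + (k + 1 : ℕ) := by
      simp only [smul_eq_mul]; push_cast; ring
    rw [e] at this
    simp only [smul_eq_mul] at this
    simp only [hp]
    linarith
  have hsb' : ∀ K, ∑ k ∈ Finset.range K, p (k + 1) ≤
      ψ (n + 1) * (1 + 4 * n / ((n : ℝ) / (η n - n) - 2)) := by
    intro K
    simp_rw [hp1]
    exact hsb K
  have hsum : Summable fun k => p (k + 1) := summable_of_sum_range_le (fun k => hp0 _) hsb'
  have hts := Real.tsum_le_of_sum_range_le (fun k => hp0 (k + 1)) hsb'
  have hmain := main_seq p hp0 hpa hpc hsum (fun t => xPt β n (stepIdx β n t)) (π / (2 * n))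
    (by positivity) (step_close β n hn)
  have hP : ∀ t, PsiN ψ n t = p 0 / 2 + ∑' k : ℕ, p (k + 1) * Real.cos ((k + 1) * t) := by
    intro t
    unfold PsiN
    simp_rw [hp1]
    simp [hp]
  unfold PsiBar
  simp_rw [hP]
  refine hmain.trans ?_
  refine (mul_le_mul_of_nonneg_left hts (by positivity)).trans ?_
  set m := (n : ℝ) / (η n - n) with hm
  have hψ : 0 < ψ (n + 1) := hpos _ (by linarith)
  have e : 8 * π * (π / (2 * n)) * (ψ (n + 1) * (1 + 4 * n / (m - 2)))
      = 4 * π ^ 2 * ψ (n + 1) * (1 / n + 4 / (m - 2)) := by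
    have : m - 2 ≠ 0 := by linarith
    have : (n:ℝ) ≠ 0 := by linarith
    field_simp
    ring
  rw [e]
  have h1 : 0 < 1 / (m - 2) := one_div_pos.2 (by linarith)
  have h2 : 0 < 1 / (n:ℝ) := by positivity
  have h3 : 1 / (n:ℝ) + 4 / (m - 2) ≤ 4 * (1 / n + 1 / (m - 2)) := by
    have : 4 / (m - 2) = 4 * (1 / (m - 2)) := by ring
    linarith
  have := mul_le_mul_of_nonneg_left h3 (show 0 ≤ 4 * π ^ 2 * ψ (n + 1) by positivity)
  linarith
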